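/- Let ρ_0, ρ_1 > 0 and let 1 ≤ M ≤ N be integers with ξ_1(N,M,m) = Σ_{i=m}^{M−1} ((M−i)/M) binom(N,i) binom(i,m) (−1)^{i−m}. Define the one-dominant-interference SINR distribution function F(x) = 1 − ρ_0/(ρ_1 x + ρ_0) for x ≥ 0 (so F(x) = ρ_1 x/(ρ_1 x + ρ_0)), its best-M transform F_Y(x) = Σ_{m=0}^{M−1} ξ_1(N,M,m) F(x)^{N−m}, and f_Y(x) = F_Y'(x). Then lim_{x→∞} x f_Y(x)/(1 − F_Y(x)) = 1, i.e., F_Y satisfies the von Mises condition for the Fréchet domain of attraction with index 1. -/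

import Mathlib

open Filter Finset

/-- The best-M feedback coefficient ξ₁(N, M, m). -/
noncomputable def xi1 (N M m : ℕ) : ℝ :=
  ∑ i ∈ Finset.Icc m (M - 1),
    (((M : ℝ) - i) / M) * (N.choose i) * (i.choose m) * (-1 : ℝ) ^ (i - m)

/-- The best-M transform as a polynomial in the underlying distribution function, written in
Bernstein form. -/
noncomputable def bestMPoly (N M : ℕ) : Polynomial ℝ :=
  ∑ i ∈ Finset.range M, Polynomial.C (((M : ℝ) - i) / M * N.choose i) *
    (Polynomial.X ^ (N - i) * (1 - Polynomial.X) ^ i)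

theorem sum_choose_mul_neg_one_pow_mul_pow {R : Type*} [CommRing R] {N i : ℕ} (hi : i ≤ N)
    (t : R) :
    ∑ m ∈ Finset.range (i + 1), (i.choose m : R) * (-1) ^ (i - m) * t ^ (N - m) =
      t ^ (N - i) * (1 - t) ^ i := by
  rw [show (1 - t) = 1 + -t by ring, add_pow, Finset.mul_sum]
  refine Finset.sum_congr rfl fun m hm => ?_
  have hm : m ≤ i := Nat.lt_succ_iff.mp (Finset.mem_range.mp hm)
  rw [show N - m = (N - i) + (i - m) by omega, pow_add, neg_pow t]
  ring

theorem sum_xi1_mul_pow {N M : ℕ} (hMN : M ≤ N) (t : ℝ) :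
    ∑ m ∈ Finset.range M, xi1 N M m * t ^ (N - m) = (bestMPoly N M).eval t := by
  simp only [xi1, bestMPoly, Polynomial.eval_finsetSum, Finset.sum_mul]
  rw [Finset.sum_comm' (t' := Finset.range M) (s' := fun i => Finset.range (i + 1))
    (by intro m i; simp only [Finset.mem_range, Finset.mem_Icc]; omega)]
  refine Finset.sum_congr rfl fun i hi => ?_
  have hi : i < M := Finset.mem_range.mp hi
  simp only [Polynomial.eval_mul, Polynomial.eval_C, Polynomial.eval_pow, Polynomial.eval_X,
    Polynomial.eval_sub, Polynomial.eval_one]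
  rw [← sum_choose_mul_neg_one_pow_mul_pow (by omega : i ≤ N), Finset.mul_sum]
  exact Finset.sum_congr rfl fun m _ => by ring

theorem bestMPoly_eval_one {N M : ℕ} (hM : 1 ≤ M) : (bestMPoly N M).eval 1 = 1 := by
  obtain ⟨k, rfl⟩ := Nat.exists_eq_add_of_le' hM
  have hk : (k : ℝ) + 1 ≠ 0 := by positivity
  simp [bestMPoly, Polynomial.eval_finsetSum, Finset.sum_range_succ', hk]

theorem bestMPoly_derivative_eval_one {N M : ℕ} (hM : 1 ≤ M) :
    (bestMPoly N M).derivative.eval 1 = N / M := by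
  obtain ⟨k, rfl⟩ := Nat.exists_eq_add_of_le' hM
  cases k with
  | zero => simp [bestMPoly, Polynomial.derivative_X_pow]
  | succ k =>
    have hk : (k : ℝ) + 1 + 1 ≠ 0 := by positivity
    simp [bestMPoly, Polynomial.eval_finsetSum, Polynomial.derivative_mul,
      Polynomial.derivative_pow, Finset.sum_range_succ', hk]
    field_simp
    ring

theorem Polynomial.tendsto_one_sub_eval_div {P : Polynomial ℝ} (h : P.eval 1 = 1) :
    Tendsto (fun t => (1 - P.eval t) / (1 - t)) (nhdsWithin 1 {1}ᶜ)
      (nhds (P.derivative.eval 1)) := by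
  refine (hasDerivAt_iff_tendsto_slope.mp (P.hasDerivAt 1)).congr fun t => ?_
  rw [slope_def_field, h, ← neg_sub 1 (P.eval t), ← neg_sub 1 t, neg_div_neg_eq]

theorem bestM_interference_frechet_condition (ρ₀ ρ₁ : ℝ) (hρ₀ : 0 < ρ₀) (hρ₁ : 0 < ρ₁)
    (N M : ℕ) (hM : 1 ≤ M) (hMN : M ≤ N)
    (F FY fY : ℝ → ℝ)
    (hF : ∀ x, F x = ρ₁ * x / (ρ₁ * x + ρ₀))
    (hFY : ∀ x, FY x = ∑ m ∈ Finset.range M, xi1 N M m * (F x) ^ (N - m))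
    (hfY : ∀ x, fY x = deriv FY x) :
    Tendsto (fun x => x * fY x / (1 - FY x)) atTop (nhds 1) := by
  set P := bestMPoly N M
  have hP : P.derivative.eval 1 ≠ 0 := by
    rw [bestMPoly_derivative_eval_one hM]
    exact div_ne_zero (by norm_cast; omega) (by norm_cast; omega)
  have hFY' : FY = fun x => P.eval (F x) := funext fun x => by rw [hFY, sum_xi1_mul_pow hMN]
  have hpos : ∀ x > 0, 0 < ρ₁ * x + ρ₀ := fun x hx => by positivity
  have hsub : ∀ x > 0, 1 - F x = ρ₀ / (ρ₁ * x + ρ₀) := fun x hx => by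
    have := (hpos x hx).ne'
    rw [hF]; field_simp; ring
  have hsub_pos : ∀ x > 0, 0 < 1 - F x := fun x hx => by
    rw [hsub x hx]; exact div_pos hρ₀ (hpos x hx)
  have hF_lim : Tendsto F atTop (nhds 1) := by
    have h : Tendsto (fun x : ℝ => ρ₀ / (ρ₁ * x + ρ₀)) atTop (nhds 0) :=
      (tendsto_atTop_add_const_right _ _ (tendsto_id.const_mul_atTop hρ₁)).const_div_atTop ρ₀
    have h1 := h.const_sub 1
    rw [sub_zero] at h1
    refine h1.congr' ?_
    filter_upwards [eventually_gt_atTop 0] with x hx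
    linarith [hsub x hx]
  have hF_ne : Tendsto F atTop (nhdsWithin 1 {1}ᶜ) := by
    refine tendsto_nhdsWithin_iff.mpr ⟨hF_lim, ?_⟩
    filter_upwards [eventually_gt_atTop 0] with x hx
    exact (sub_pos.mp (hsub_pos x hx)).ne
  have hfY' : ∀ x > 0, x * fY x = P.derivative.eval (F x) * (F x * (1 - F x)) := fun x hx => by
    have hne := (hpos x hx).ne'
    have hlin : HasDerivAt (fun y => ρ₁ * y) ρ₁ x := by
      simpa using (hasDerivAt_id x).const_mul ρ₁
    have hdF : HasDerivAt F ((ρ₁ * (ρ₁ * x + ρ₀) - ρ₁ * x * ρ₁) / (ρ₁ * x + ρ₀) ^ 2) x := by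
      rw [funext hF]
      exact hlin.fun_div (hlin.add_const ρ₀) hne
    have hd := (P.hasDerivAt (F x)).comp x hdF
    rw [hfY, hFY', show deriv (fun x => P.eval (F x)) x = _ from hd.deriv, hsub x hx, hF]
    field_simp
    ring
  have hlim := (((P.derivative.continuous.tendsto 1).comp hF_lim).mul hF_lim).div
    ((Polynomial.tendsto_one_sub_eval_div (bestMPoly_eval_one hM)).comp hF_ne) hP
  rw [mul_one, div_self hP] at hlim
  refine hlim.congr' ?_
  filter_upwards [eventually_gt_atTop 0] with x hx
  rw [hfY' x hx, hFY']
  simp only [Pi.div_apply, Function.comp_apply]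
  rw [div_div_eq_mul_div, mul_assoc]
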